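/- Let X be a C*-algebra, B a norm-closed subalgebra of X, and A a norm-closed two-sided ideal of B admitting a contractive approximate identity. Then the following are equivalent: (1) B admits a contractive approximate identity; (2) the quotient B/A is approximately unital, i.e., there exists a net (u_s) in B with dist(u_s, A) ≤ 1 for all s such that dist(u_s·b − b, A) → 0 and dist(b·u_s − b, A) → 0 for every b ∈ B. -/

import Mathlib

open Filter Topology Metric

/-- `S` is a norm-closed (not necessarily self-adjoint or unital) subalgebra:
a norm-closed ℂ-linear subspace closed under multiplication. -/
structure IsClosedSubalg (X : Type*) [NonUnitalNormedRing X] [NormedSpace ℂ X]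
    (S : Set X) : Prop where
  isClosed : IsClosed S
  zero_mem : (0 : X) ∈ S
  add_mem : ∀ {x y : X}, x ∈ S → y ∈ S → x + y ∈ S
  smul_mem : ∀ (c : ℂ) {x : X}, x ∈ S → c • x ∈ S
  mul_mem : ∀ {x y : X}, x ∈ S → y ∈ S → x * y ∈ S

/-- A contractive net drawn from `A` which is a two-sided approximate identity for `D`. -/
def IsCaiFor (X : Type*) [NonUnitalNormedRing X] (A D : Set X) : Prop :=
  ∃ (ι : Type) (l : Filter ι) (e : ι → X), l.NeBot ∧
    (∀ t, e t ∈ A) ∧ (∀ t, ‖e t‖ ≤ 1) ∧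
    (∀ d ∈ D, Tendsto (fun t => ‖e t * d - d‖) l (𝓝 0)) ∧
    (∀ d ∈ D, Tendsto (fun t => ‖d * e t - d‖) l (𝓝 0))

/-- The average of the first `n` terms of a sequence. -/
noncomputable def seqAverage {X : Type*} [NonUnitalNormedRing X] [NormedSpace ℂ X]
    (f : ℕ → X) (n : ℕ) : X :=
  (n : ℂ)⁻¹ • ∑ j ∈ Finset.range n, f j

section Average

variable {X : Type*} [NonUnitalNormedRing X] [NormedSpace ℂ X]

theorem seqAverage_sub (f g : ℕ → X) (n : ℕ) :
    seqAverage (fun j => f j - g j) n = seqAverage f n - seqAverage g n := by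
  simp only [seqAverage, Finset.sum_sub_distrib, smul_sub]

theorem seqAverage_const (x : X) {n : ℕ} (hn : 0 < n) : seqAverage (fun _ => x) n = x := by
  have hn0 : (n : ℂ) ≠ 0 := by exact_mod_cast hn.ne'
  simp [seqAverage, ← Nat.cast_smul_eq_nsmul ℂ, smul_smul, hn0]

theorem seqAverage_mul [IsScalarTower ℂ X X] (f : ℕ → X) (x : X) (n : ℕ) :
    seqAverage (fun j => f j * x) n = seqAverage f n * x := by
  simp only [seqAverage, smul_mul_assoc, Finset.sum_mul]

theorem mul_seqAverage [SMulCommClass ℂ X X] (f : ℕ → X) (x : X) (n : ℕ) :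
    seqAverage (fun j => x * f j) n = x * seqAverage f n := by
  simp only [seqAverage, mul_smul_comm, Finset.mul_sum]

theorem norm_seqAverage_le {f : ℕ → X} {C : ℝ} (hC : 0 ≤ C) (hf : ∀ j, ‖f j‖ ≤ C) (n : ℕ) :
    ‖seqAverage f n‖ ≤ C := by
  rcases n.eq_zero_or_pos with rfl | hn
  · simpa [seqAverage] using hC
  · have hn1 : (0 : ℝ) < n := by exact_mod_cast hn
    rw [seqAverage, norm_smul, norm_inv, RCLike.norm_natCast, inv_mul_le_iff₀ hn1]
    simpa using norm_sum_le_of_le (Finset.range n) fun j _ => hf j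

theorem IsClosedSubalg.seqAverage_mem {S : Set X} (hS : IsClosedSubalg X S) {f : ℕ → X}
    (hf : ∀ j, f j ∈ S) (n : ℕ) : seqAverage f n ∈ S := by
  refine hS.smul_mem _ ?_
  induction n with
  | zero => simpa using hS.zero_mem
  | succ n ih => rw [Finset.sum_range_succ]; exact hS.add_mem ih (hf n)

theorem IsClosedSubalg.sub_mem {S : Set X} (hS : IsClosedSubalg X S) {x y : X}
    (hx : x ∈ S) (hy : y ∈ S) : x - y ∈ S := by
  rw [sub_eq_add_neg, ← neg_one_smul ℂ y]
  exact hS.add_mem hx (hS.smul_mem _ hy)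

end Average

attribute [local instance] CStarAlgebra.spectralOrder CStarAlgebra.spectralOrderedRing in
theorem norm_one_sub_star_mul_self_le_one {Y : Type*} [CStarAlgebra Y] {e : Y} (he : ‖e‖ ≤ 1) :
    ‖1 - star e * e‖ ≤ 1 := by
  have h1 : ‖star e * e‖ ≤ 1 := by
    rw [CStarRing.norm_star_mul_self]; nlinarith [norm_nonneg e]
  have h0 : 0 ≤ star e * e := star_mul_self_nonneg e
  have h2 : star e * e ≤ 1 := (CStarAlgebra.norm_le_one_iff_of_nonneg _ h0).1 h1
  rw [CStarAlgebra.norm_le_one_iff_of_nonneg _ (sub_nonneg.2 h2)]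
  exact sub_le_self _ h0

attribute [local instance] CStarAlgebra.spectralOrder CStarAlgebra.spectralOrderedRing in
theorem one_sub_star_mul_self_nonneg {Y : Type*} [CStarAlgebra Y] {e : Y} (he : ‖e‖ ≤ 1) :
    0 ≤ 1 - star e * e := by
  have h1 : ‖star e * e‖ ≤ 1 := by
    rw [CStarRing.norm_star_mul_self]; nlinarith [norm_nonneg e]
  exact sub_nonneg.2 <| (CStarAlgebra.norm_le_one_iff_of_nonneg _ (star_mul_self_nonneg e)).1 h1

attribute [local instance] CStarAlgebra.spectralOrder CStarAlgebra.spectralOrderedRing in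
theorem norm_corner_sum_le_one {Y : Type*} [CStarAlgebra Y] {g u : Y}
    (hg : star g = g) (hg1 : ‖g‖ ≤ 1) (hu : ‖u‖ ≤ 1) :
    ‖(1 - g * g) + g * u * g‖ ≤ 1 := by
  set v := (1 - g * g) + g * u * g with hv
  have hq : 0 ≤ 1 - g * g := by simpa [hg] using one_sub_star_mul_self_nonneg hg1
  have key : 1 - star v * v =
      star g * (star (1 - u) * (1 - g * g) * (1 - u) + (1 - star u * u)) * g := by
    simp only [hv, star_add, star_sub, star_mul, star_one, hg]
    noncomm_ring
  have hpos : 0 ≤ 1 - star v * v := by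
    rw [key]
    exact star_left_conjugate_nonneg
      (add_nonneg (star_left_conjugate_nonneg hq _) (one_sub_star_mul_self_nonneg hu)) _
  have h1 := (CStarAlgebra.norm_le_one_iff_of_nonneg _ (star_mul_self_nonneg v)).2
    (sub_nonneg.1 hpos)
  rw [CStarRing.norm_star_mul_self] at h1
  nlinarith [norm_nonneg v]

attribute [local instance] CStarAlgebra.spectralOrder CStarAlgebra.spectralOrderedRing in
theorem norm_star_mul_sub_sq_le_aux {Y : Type*} [CStarAlgebra Y] {e : Y} (he : ‖e‖ ≤ 1) (c : Y) :
    ‖star e * c - c‖ ^ 2 ≤ 2 * ‖c‖ * ‖e * c - c‖ := by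
  have h1 : 0 ≤ star c * (1 - star (star e) * star e) * c :=
    star_left_conjugate_nonneg (one_sub_star_mul_self_nonneg (by simpa using he)) _
  have h2 : star (star e * c - c) * (star e * c - c) ≤
      -(star c * (e * c - c) + star (e * c - c) * c) := by
    rw [← sub_nonneg]
    convert h1 using 1
    simp only [star_sub, star_mul, star_star]
    noncomm_ring
  have h3 := CStarAlgebra.norm_le_norm_of_nonneg_of_le (star_mul_self_nonneg _) h2
  rw [CStarRing.norm_star_mul_self, norm_neg] at h3
  have h4 := norm_add_le (star c * (e * c - c)) (star (e * c - c) * c)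
  have h5 := norm_mul_le (star c) (e * c - c)
  have h6 := norm_mul_le (star (e * c - c)) c
  rw [norm_star] at h5 h6
  nlinarith

theorem norm_star_mul_sub_sq_le {X : Type*} [NonUnitalCStarAlgebra X] {e : X} (he : ‖e‖ ≤ 1)
    (c : X) : ‖star e * c - c‖ ^ 2 ≤ 2 * ‖c‖ * ‖e * c - c‖ := by
  have h := norm_star_mul_sub_sq_le_aux (Y := Unitization ℂ X) (e := (e : Unitization ℂ X))
    (by rwa [Unitization.norm_inr]) (c : Unitization ℂ X)
  simpa only [← Unitization.inr_star, ← Unitization.inr_mul, ← Unitization.inr_sub,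
    Unitization.norm_inr] using h

theorem norm_average_corner_le_one {X : Type*} [NonUnitalCStarAlgebra X] {n : ℕ} (hn : 0 < n)
    {e : ℕ → X} (he : ∀ j, ‖e j‖ ≤ 1) {u h : X} (hu : ‖u‖ ≤ 1)
    (hh : h = seqAverage (fun j => star (e j) * e j) n) :
    ‖h + h - h * h + (u - h * u - u * h + h * u * h)‖ ≤ 1 := by
  have hstar : star h = h := by
    simp [hh, seqAverage, star_sum]
  have hg : (1 : Unitization ℂ X) - (h : Unitization ℂ X) =
      seqAverage (fun j => 1 - star (e j : Unitization ℂ X) * (e j : Unitization ℂ X)) n := by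
    rw [seqAverage_sub, seqAverage_const _ hn, hh, seqAverage, seqAverage, Unitization.inr_smul]
    congr 2
    refine (map_sum (Unitization.inrNonUnitalAlgHom ℂ X) _ _).trans ?_
    simp
  have hg1 : ‖(1 : Unitization ℂ X) - (h : Unitization ℂ X)‖ ≤ 1 := by
    rw [hg]
    exact norm_seqAverage_le zero_le_one (fun j => norm_one_sub_star_mul_self_le_one
      (by rw [Unitization.norm_inr]; exact he j)) n
  have := norm_corner_sum_le_one (g := (1 : Unitization ℂ X) - (h : Unitization ℂ X))
    (u := (u : Unitization ℂ X)) (by rw [star_sub, star_one, ← Unitization.inr_star, hstar]) hg1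
    (by rwa [Unitization.norm_inr])
  rw [← Unitization.norm_inr (𝕜 := ℂ)]
  convert this using 2
  simp only [Unitization.inr_add, Unitization.inr_sub, Unitization.inr_mul]
  noncomm_ring

theorem norm_sum_sq_le_of_star_mul_le {X : Type*} [NonUnitalCStarAlgebra X] {d : ℕ → X} {M δ : ℝ}
    (hM : ∀ i, ‖d i‖ ≤ M) (hδ0 : 0 ≤ δ) (hδ : ∀ i j, i < j → ‖star (d i) * d j‖ ≤ δ) (n : ℕ) :
    ‖∑ i ∈ Finset.range n, d i‖ ^ 2 ≤ n * M ^ 2 + n ^ 2 * δ := by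
  have h : ∀ i j, ‖star (d i) * d j‖ ≤ (if i = j then M ^ 2 else 0) + δ := by
    intro i j
    rcases lt_trichotomy i j with hij | rfl | hij
    · simpa [hij.ne] using hδ i j hij
    · rw [CStarRing.norm_star_mul_self, if_pos rfl]
      nlinarith [norm_nonneg (d i), hM i]
    · rw [← norm_star, star_mul, star_star]
      simpa [hij.ne'] using hδ j i hij
  calc ‖∑ i ∈ Finset.range n, d i‖ ^ 2
      = ‖∑ i ∈ Finset.range n, ∑ j ∈ Finset.range n, star (d i) * d j‖ := by
        rw [sq, ← CStarRing.norm_star_mul_self, star_sum, Finset.sum_mul_sum]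
    _ ≤ ∑ i ∈ Finset.range n, ∑ j ∈ Finset.range n, ((if i = j then M ^ 2 else 0) + δ) :=
        norm_sum_le_of_le _ fun i _ => norm_sum_le_of_le _ fun j _ => h i j
    _ = n * M ^ 2 + n ^ 2 * δ := by
        simp only [Finset.sum_add_distrib, Finset.sum_const, Finset.card_range, nsmul_eq_mul]
        congr 1
        · rw [Finset.sum_congr rfl (g := fun _ => M ^ 2)]
          · simp
          · intro i hi
            rw [Finset.sum_ite_eq, if_pos hi]
        · ring

theorem exists_seq_norm_average_le {X ι : Type*} [NonUnitalCStarAlgebra X] {l : Filter ι} [l.NeBot]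
    {K : Set (ι → X)} (hK : K.Finite) (hbdd : ∀ d ∈ K, ∃ M, ∀ t, ‖d t‖ ≤ M)
    (horth : ∀ d ∈ K, ∀ x, Tendsto (fun y => star (d x) * d y) l (𝓝 0))
    {P : ι → Prop} (hP : ∀ᶠ t in l, P t) {ε : ℝ} (hε : 0 < ε) :
    ∃ (t : ℕ → ι) (n : ℕ), 0 < n ∧ (∀ j, P (t j)) ∧
      ∀ d ∈ K, ‖seqAverage (fun j => d (t j)) n‖ ≤ ε := by
  have hδ : 0 < ε ^ 2 / 2 := by positivity
  obtain ⟨t, htP, ht⟩ := exists_seq_of_forall_finset_exists P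
    (fun x y => ∀ d ∈ K, ‖star (d x) * d y‖ ≤ ε ^ 2 / 2) (by
      intro s _
      have h1 : ∀ᶠ y in l, ∀ x ∈ s, ∀ d ∈ K, ‖star (d x) * d y‖ ≤ ε ^ 2 / 2 := by
        rw [Filter.eventually_all_finset]
        intro x _
        rw [Filter.eventually_all_finite hK]
        intro d hd
        have := (horth d hd x).norm
        rw [norm_zero] at this
        exact (this.eventually_lt_const hδ).mono fun _ h => h.le
      exact (hP.and h1).exists)
  have hn : ∀ᶠ n : ℕ in atTop, ∀ d ∈ K, ∃ M : ℝ, (∀ t, ‖d t‖ ≤ M) ∧ M ^ 2 ≤ n * (ε ^ 2 / 2) := by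
    rw [Filter.eventually_all_finite hK]
    intro d hd
    obtain ⟨M, hM⟩ := hbdd d hd
    filter_upwards [(tendsto_natCast_atTop_atTop (R := ℝ)).eventually_ge_atTop
      (M ^ 2 / (ε ^ 2 / 2))] with n hn
    exact ⟨M, hM, (div_le_iff₀ hδ).1 hn⟩
  obtain ⟨n, hn, hn0⟩ := (hn.and (eventually_gt_atTop 0)).exists
  refine ⟨t, n, hn0, htP, fun d hd => ?_⟩
  obtain ⟨M, hM, hMn⟩ := hn d hd
  have hn1 : (0 : ℝ) < n := by exact_mod_cast hn0
  rw [seqAverage, norm_smul, norm_inv, RCLike.norm_natCast, inv_mul_le_iff₀ hn1]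
  refine abs_le_of_sq_le_sq' ?_ (by positivity) |>.2
  calc _ ≤ (n : ℝ) * M ^ 2 + n ^ 2 * (ε ^ 2 / 2) :=
        norm_sum_sq_le_of_star_mul_le (fun i => hM (t i)) hδ.le
          (fun i j hij => ht i j hij d hd) n
    _ ≤ (n * ε) ^ 2 := by nlinarith

section LeftUnit

variable {X ι : Type*} [NonUnitalCStarAlgebra X] {l : Filter ι} {e : ι → X}

theorem tendsto_star_mul_of_tendsto_mul (he : ∀ t, ‖e t‖ ≤ 1) {c : X}
    (hc : Tendsto (fun t => e t * c) l (𝓝 c)) : Tendsto (fun t => star (e t) * c) l (𝓝 c) := by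
  rw [tendsto_iff_norm_sub_tendsto_zero] at hc ⊢
  have h1 : Tendsto (fun t => √(2 * ‖c‖ * ‖e t * c - c‖)) l (𝓝 0) := by
    simpa using (hc.const_mul (2 * ‖c‖)).sqrt
  exact squeeze_zero (fun _ => norm_nonneg _)
    (fun t => Real.le_sqrt_of_sq_le (norm_star_mul_sub_sq_le (he t) c)) h1

theorem tendsto_mul_star_of_tendsto_mul (he : ∀ t, ‖e t‖ ≤ 1) {a : X}
    (ha : Tendsto (fun t => a * e t) l (𝓝 a)) :
    Tendsto (fun t => e t * star a) l (𝓝 (star a)) := by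
  have h := tendsto_star_mul_of_tendsto_mul (e := fun t => star (e t)) (c := star a) (l := l)
    (fun t => by simpa using he t) (by simpa using ha.star)
  simpa using h

theorem tendsto_mul_of_forall_exists_near (he : ∀ t, ‖e t‖ ≤ 1) {c : X}
    (hc : ∀ ε > 0, ∃ c', Tendsto (fun t => e t * c') l (𝓝 c') ∧ ‖c - c'‖ < ε) :
    Tendsto (fun t => e t * c) l (𝓝 c) := by
  rw [Metric.tendsto_nhds]
  intro ε hε
  obtain ⟨c', hc', hcc'⟩ := hc (ε / 3) (by positivity)
  filter_upwards [Metric.tendsto_nhds.1 hc' (ε / 3) (by positivity)] with t ht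
  rw [dist_eq_norm] at ht ⊢
  have h1 : e t * c - c = e t * (c - c') + (e t * c' - c') - (c - c') := by
    rw [mul_sub]; abel
  have h2 : ‖e t * (c - c')‖ ≤ ‖c - c'‖ :=
    (norm_mul_le _ _).trans (mul_le_of_le_one_left (norm_nonneg _) (he t))
  rw [h1]
  have h3 := norm_sub_le (e t * (c - c') + (e t * c' - c')) (c - c')
  have h4 := norm_add_le (e t * (c - c')) (e t * c' - c')
  linarith

end LeftUnit

theorem norm_sub_mul_le_two_mul {X : Type*} [NonUnitalNormedRing X] {e x : X} (he : ‖e‖ ≤ 1) :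
    ‖x - e * x‖ ≤ 2 * ‖x‖ ∧ ‖x - x * e‖ ≤ 2 * ‖x‖ := by
  have h1 := norm_mul_le e x
  have h2 := norm_mul_le x e
  have h3 := norm_sub_le x (e * x)
  have h4 := norm_sub_le x (x * e)
  have := norm_nonneg x
  constructor <;> nlinarith

/-- The average of a quasi-central contractive approximate identity that is close to an average of
the positive contractions `star (e j) * e j`. -/
theorem exists_quasicentral_average {X ι : Type*} [NonUnitalCStarAlgebra X] {l : Filter ι}
    [l.NeBot] {e : ι → X} {A B : Set X}
    (hAideal : ∀ a ∈ A, ∀ b ∈ B, a * b ∈ A ∧ b * a ∈ A)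
    (hA : IsClosedSubalg X A)
    (heA : ∀ t, e t ∈ A) (he : ∀ t, ‖e t‖ ≤ 1)
    (hl : ∀ a ∈ A, Tendsto (fun t => e t * a) l (𝓝 a))
    (hr : ∀ a ∈ A, Tendsto (fun t => a * e t) l (𝓝 a))
    {F G : Set X} (hF : F.Finite) (hFB : F ⊆ B) (hG : G.Finite) (hGA : G ⊆ A)
    {ε : ℝ} (hε : 0 < ε) :
    ∃ (t : ℕ → ι) (n : ℕ), 0 < n ∧
      (∀ a ∈ G, ‖a - seqAverage (fun j => e (t j)) n * a‖ ≤ ε) ∧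
      ‖seqAverage (fun j => e (t j)) n - seqAverage (fun j => star (e (t j)) * e (t j)) n‖ ≤ ε ∧
      ∀ b ∈ F, ‖seqAverage (fun j => e (t j)) n * b - b * seqAverage (fun j => e (t j)) n‖ ≤ ε := by
  have hls : ∀ c, Tendsto (fun t => e t * c) l (𝓝 c) → Tendsto (fun t => star (e t) * c) l (𝓝 c) :=
    fun c hc => tendsto_star_mul_of_tendsto_mul he hc
  have hlA : ∀ a ∈ A, Tendsto (fun t => e t * star a) l (𝓝 (star a)) :=
    fun a ha => tendsto_mul_star_of_tendsto_mul he (hr a ha)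
  have hmul : ∀ c x, Tendsto (fun t => e t * c) l (𝓝 c) →
      Tendsto (fun t => e t * (c * x)) l (𝓝 (c * x)) :=
    fun c x hc => by simpa only [mul_assoc] using hc.mul_const x
  have hBA : ∀ b ∈ B, ∀ c ∈ A, Tendsto (fun t => e t * (star b * c)) l (𝓝 (star b * c)) := by
    intro b hb c hc
    refine tendsto_mul_of_forall_exists_near he fun δ hδ => ?_
    have h1 : Tendsto (fun s => ‖star b * c - star b * (star (e s) * c)‖) l (𝓝 0) := by
      simpa using (((hls c (hl c hc)).const_mul (star b)).const_sub (star b * c)).norm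
    obtain ⟨s, hs⟩ := (h1.eventually_lt_const hδ).exists
    refine ⟨star b * (star (e s) * c), ?_, hs⟩
    rw [← mul_assoc, ← star_mul]
    exact hmul _ _ (hlA _ (hAideal _ (heA s) b hb).1)
  have hconv : ∀ d : ι → X, (∀ x, Tendsto (fun y => star (d y) * d x) l (𝓝 0)) →
      ∀ x, Tendsto (fun y => star (d x) * d y) l (𝓝 0) :=
    fun d h x => by simpa using (h x).star
  let K : Set (ι → X) :=
    insert (fun t => e t - star (e t) * e t) ((fun b t => e t * b - b * e t) '' F)
  have hbdd : ∀ d ∈ K, ∃ M, ∀ t, ‖d t‖ ≤ M := by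
    rintro d (rfl | ⟨b, -, rfl⟩)
    · refine ⟨2, fun t => (norm_sub_le _ _).trans ?_⟩
      rw [CStarRing.norm_star_mul_self]
      nlinarith [he t, norm_nonneg (e t)]
    · refine ⟨2 * ‖b‖, fun t => (norm_sub_le _ _).trans ?_⟩
      nlinarith [he t, norm_nonneg b, norm_mul_le (e t) b, norm_mul_le b (e t)]
  have horth : ∀ d ∈ K, ∀ x, Tendsto (fun y => star (d x) * d y) l (𝓝 0) := by
    rintro d (rfl | ⟨b, hb, rfl⟩) <;> refine hconv _ fun x => ?_
    · have hc : Tendsto (fun t => e t * (e x - star (e x) * e x)) l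
          (𝓝 (e x - star (e x) * e x)) := by
        simpa only [mul_sub] using (hl _ (heA x)).sub (hmul _ (e x) (hlA _ (heA x)))
      have h1 : Tendsto (fun t => star (e t) * (e t * (e x - star (e x) * e x))) l
          (𝓝 (e x - star (e x) * e x)) := by
        have h2 : Tendsto (fun t => star (e t) * (e t * (e x - star (e x) * e x) -
            (e x - star (e x) * e x))) l (𝓝 0) := by
          have h3 := (tendsto_iff_norm_sub_tendsto_zero.1 hc)
          refine squeeze_zero_norm (fun t => (norm_mul_le _ _).trans ?_) h3
          rw [norm_star]
          exact mul_le_of_le_one_left (norm_nonneg _) (he t)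
        simpa [mul_sub] using h2.add (hls _ hc)
      simpa [sub_mul, mul_assoc] using (hls _ hc).sub h1
    · have hcA : e x * b - b * e x ∈ A :=
        hA.sub_mem (hAideal _ (heA x) b (hFB hb)).1 (hAideal _ (heA x) b (hFB hb)).2
      have h1 := (hls _ (hl _ hcA)).const_mul (star b)
      have h2 := hls _ (hBA b (hFB hb) _ hcA)
      simpa only [star_sub, star_mul, sub_mul, mul_assoc, sub_self] using h1.sub h2
  have hev : ∀ᶠ t in l, ∀ a ∈ G, ‖e t * a - a‖ ≤ ε := by
    rw [Filter.eventually_all_finite hG]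
    intro a ha
    exact ((tendsto_iff_norm_sub_tendsto_zero.1 (hl a (hGA ha))).eventually_lt_const hε).mono
      fun _ h => h.le
  obtain ⟨t, n, hn, htG, ht⟩ :=
    exists_seq_norm_average_le (K := K) ((hF.image _).insert _) hbdd horth hev hε
  refine ⟨t, n, hn, fun a ha => ?_, ?_, fun b hb => ?_⟩
  · rw [← norm_neg, neg_sub]
    nth_rw 2 [← seqAverage_const a hn]
    rw [← seqAverage_mul, ← seqAverage_sub]
    exact norm_seqAverage_le hε.le (fun j => htG j a ha) n
  · rw [← seqAverage_sub]
    exact ht _ (Set.mem_insert _ _)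
  · rw [← seqAverage_mul, ← mul_seqAverage, ← seqAverage_sub]
    exact ht _ (Set.mem_insert_of_mem _ ⟨b, hb, rfl⟩)

/-- In a unital ring this is `1 - (1 - e) ^ 2 + (1 - e) * w * (1 - e)`. -/
def cornerSum {X : Type*} [NonUnitalRing X] (e w : X) : X :=
  e + e - e * e + (w - e * w - w * e + e * w * e)

section CornerSum

variable {X : Type*} [NonUnitalNormedRing X]

theorem norm_corner_le {e a y k z : X} {δ : ℝ} (he : ‖e‖ ≤ 1)
    (hy : ‖y - a‖ ≤ δ) (ha : ‖a - e * a‖ ≤ δ) (hk : ‖z‖ ≤ 4 * ‖k‖) (hkδ : ‖k‖ ≤ δ) :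
    ‖((y - e * y) - (y - e * y) * e) + z‖ ≤ 10 * δ := by
  have h1 : y - e * y = (a - e * a) + ((y - a) - e * (y - a)) := by
    rw [mul_sub]; abel
  have h2 := norm_add_le (a - e * a) ((y - a) - e * (y - a))
  rw [← h1] at h2
  have h3 := (norm_sub_mul_le_two_mul he (x := y - a)).1
  have h4 := (norm_sub_mul_le_two_mul he (x := y - e * y)).2
  have h5 := norm_add_le ((y - e * y) - (y - e * y) * e) z
  linarith

theorem norm_cornerSum_mul_sub_le {e w b a : X} {δ : ℝ} (he : ‖e‖ ≤ 1) (hw : ‖w‖ ≤ 1)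
    (hx : ‖w * b - b - a‖ ≤ δ) (ha : ‖a - e * a‖ ≤ δ) (hk : ‖e * b - b * e‖ ≤ δ) :
    ‖cornerSum e w * b - b‖ ≤ 10 * δ := by
  set k := e * b - b * e with hkdef
  have h1 : cornerSum e w * b - b = ((w * b - b - e * (w * b - b)) -
      (w * b - b - e * (w * b - b)) * e) + ((k - w * k) - e * (k - w * k)) := by
    simp only [cornerSum, hkdef, add_mul, sub_mul, mul_sub, mul_assoc]
    abel
  rw [h1]
  refine norm_corner_le he hx ha ?_ hk
  have h2 := (norm_sub_mul_le_two_mul hw (x := k)).1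
  have h3 := (norm_sub_mul_le_two_mul he (x := k - w * k)).1
  linarith

theorem norm_mul_cornerSum_sub_le {e w b a : X} {δ : ℝ} (he : ‖e‖ ≤ 1) (hw : ‖w‖ ≤ 1)
    (hx : ‖b * w - b - a‖ ≤ δ) (ha : ‖a - e * a‖ ≤ δ) (hk : ‖e * b - b * e‖ ≤ δ) :
    ‖b * cornerSum e w - b‖ ≤ 10 * δ := by
  set k := e * b - b * e with hkdef
  have h1 : b * cornerSum e w - b = ((b * w - b - e * (b * w - b)) -
      (b * w - b - e * (b * w - b)) * e) + -((k - k * w) - (k - k * w) * e) := by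
    simp only [cornerSum, hkdef, mul_add, sub_mul, mul_sub, mul_assoc]
    abel
  rw [h1]
  refine norm_corner_le he hx ha ?_ hk
  have h2 := (norm_sub_mul_le_two_mul hw (x := k)).2
  have h3 := (norm_sub_mul_le_two_mul he (x := k - k * w)).2
  rw [norm_neg]
  linarith

theorem norm_cornerSum_sub_cornerSum_le {e h w : X} {δ : ℝ} (he : ‖e‖ ≤ 1) (hh : ‖h‖ ≤ 1)
    (hw : ‖w‖ ≤ 1) (heh : ‖e - h‖ ≤ δ) : ‖cornerSum e w - cornerSum h w‖ ≤ 8 * δ := by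
  set z := e - h with hz
  have h1 : cornerSum e w - cornerSum h w =
      z + z - (e * z + z * h) - (z * w + w * z) + (e * w * z + z * (w * h)) := by
    simp only [cornerSum, hz, sub_mul, mul_sub, mul_assoc]
    abel
  have hl : ∀ {x y : X}, ‖x‖ ≤ 1 → ‖x * y‖ ≤ ‖y‖ := fun hx =>
    (norm_mul_le _ _).trans (mul_le_of_le_one_left (norm_nonneg _) hx)
  have hr : ∀ {x y : X}, ‖y‖ ≤ 1 → ‖x * y‖ ≤ ‖x‖ := fun hy =>
    (norm_mul_le _ _).trans (mul_le_of_le_one_right (norm_nonneg _) hy)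
  rw [h1]
  refine (norm_add_le_of_le (norm_sub_le_of_le (norm_sub_le_of_le (norm_add_le z z)
    (norm_add_le_of_le (hl he) (hr hh))) (norm_add_le_of_le (hr hw) (hl hw)))
    (norm_add_le_of_le (hl ((hl he).trans hw)) (hr ((hl hw).trans hh)))).trans ?_
  linarith

theorem IsClosedSubalg.cornerSum_mem [NormedSpace ℂ X] {S : Set X} (hS : IsClosedSubalg X S)
    {e w : X} (he : e ∈ S) (hw : w ∈ S) : cornerSum e w ∈ S :=
  hS.add_mem (hS.sub_mem (hS.add_mem he he) (hS.mul_mem he he))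
    (hS.add_mem (hS.sub_mem (hS.sub_mem hw (hS.mul_mem he hw)) (hS.mul_mem hw he))
      (hS.mul_mem (hS.mul_mem he hw) he))

end CornerSum

/-- Radial rescaling into the closed unit ball. -/
noncomputable def clipNorm {X : Type*} [NonUnitalNormedRing X] [NormedSpace ℂ X] (x : X) : X :=
  ((max 1 ‖x‖ : ℝ) : ℂ)⁻¹ • x

section ClipNorm

variable {X : Type*} [NonUnitalNormedRing X] [NormedSpace ℂ X]

theorem norm_clipNorm_le_one (x : X) : ‖clipNorm x‖ ≤ 1 := by
  have h : 0 < max 1 ‖x‖ := lt_max_of_lt_left one_pos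
  rw [clipNorm, norm_smul, norm_inv, Complex.norm_real, Real.norm_of_nonneg h.le,
    inv_mul_le_iff₀ h, mul_one]
  exact le_max_right _ _

theorem norm_clipNorm_sub_le {x : X} {δ : ℝ} (hδ : 0 ≤ δ) (hx : ‖x‖ ≤ 1 + δ) :
    ‖clipNorm x - x‖ ≤ δ := by
  have h : 0 < max 1 ‖x‖ := lt_max_of_lt_left one_pos
  have h0 : ((max 1 ‖x‖ : ℝ) : ℂ) ≠ 0 := by exact_mod_cast h.ne'
  have h1 : clipNorm x - x = -(((max 1 ‖x‖ - 1 : ℝ) : ℂ) • clipNorm x) := by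
    rw [clipNorm, smul_smul, Complex.ofReal_sub, sub_mul, mul_inv_cancel₀ h0, sub_smul]
    simp
  rw [h1, norm_neg, norm_smul, Complex.norm_real,
    Real.norm_of_nonneg (sub_nonneg.2 (le_max_left _ _))]
  have h2 : max 1 ‖x‖ - 1 ≤ δ := by
    rw [sub_le_iff_le_add']; exact max_le (by linarith) hx
  exact (mul_le_of_le_one_right (sub_nonneg.2 (le_max_left _ _)) (norm_clipNorm_le_one x)).trans h2

end ClipNorm

theorem exists_contractive_approx_of_approx_modulo {X : Type*} [NonUnitalCStarAlgebra X]
    {A B : Set X} (hB : IsClosedSubalg X B) (hA : IsClosedSubalg X A) (hAB : A ⊆ B)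
    (hAideal : ∀ a ∈ A, ∀ b ∈ B, a * b ∈ A ∧ b * a ∈ A)
    {ι κ : Type*} {l : Filter ι} [l.NeBot] {e : ι → X}
    (heA : ∀ t, e t ∈ A) (he : ∀ t, ‖e t‖ ≤ 1)
    (hl : ∀ a ∈ A, Tendsto (fun t => e t * a) l (𝓝 a))
    (hr : ∀ a ∈ A, Tendsto (fun t => a * e t) l (𝓝 a))
    {w : κ → X} (hwB : ∀ s, w s ∈ B) (hw : ∀ s, ‖w s‖ ≤ 1)
    (hwA : ∀ F : Finset X, ↑F ⊆ B → ∀ δ > 0, ∃ s, ∀ b ∈ F,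
      (∃ a ∈ A, ‖w s * b - b - a‖ ≤ δ) ∧ ∃ a ∈ A, ‖b * w s - b - a‖ ≤ δ) :
    ∃ v : κ × (ℕ → ι) × ℕ → X, (∀ s, v s ∈ B) ∧ (∀ s, ‖v s‖ ≤ 1) ∧
      ∀ F : Finset X, ↑F ⊆ B → ∀ δ > 0, ∃ s, ∀ b ∈ F,
        ‖v s * b - b‖ < δ ∧ ‖b * v s - b‖ < δ := by
  refine ⟨fun p => clipNorm (cornerSum (seqAverage (fun j => e (p.2.1 j)) p.2.2) (w p.1)),
    fun p => hB.smul_mem _ (hB.cornerSum_mem (hAB (hA.seqAverage_mem (fun j => heA _) _)) (hwB _)),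
    fun p => norm_clipNorm_le_one _, fun F hF ε hε => ?_⟩
  obtain ⟨C, hC⟩ : ∃ C : ℝ, ∀ b ∈ F, ‖b‖ ≤ C :=
    ⟨∑ b ∈ F, ‖b‖, fun b hb => Finset.single_le_sum (fun x _ => norm_nonneg x) hb⟩
  set δ : ℝ := ε / (11 + 8 * |C|) with hδdef
  have hD : 0 < 11 + 8 * |C| := by positivity
  have hδ : 0 < δ := by positivity
  have hδε : 10 * δ + 8 * δ * |C| < ε := by
    have : δ * (11 + 8 * |C|) = ε := div_mul_cancel₀ _ hD.ne'
    linarith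
  obtain ⟨s, hs⟩ := hwA F hF δ hδ
  choose! a ha using fun b hb => (hs b hb).1
  choose! a' ha' using fun b hb => (hs b hb).2
  obtain ⟨t, n, hn, hG, hh, hcomm⟩ := exists_quasicentral_average hAideal hA heA he hl hr
    F.finite_toSet hF ((F.finite_toSet.image a).union (F.finite_toSet.image a'))
    (Set.union_subset (by rintro _ ⟨b, hb, rfl⟩; exact (ha b hb).1)
      (by rintro _ ⟨b, hb, rfl⟩; exact (ha' b hb).1)) hδ
  refine ⟨(s, t, n), fun b hb => ?_⟩
  set E := seqAverage (fun j => e (t j)) n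
  set H := seqAverage (fun j => star (e (t j)) * e (t j)) n with hHdef
  have hE : ‖E‖ ≤ 1 := norm_seqAverage_le zero_le_one (fun j => he _) n
  have hH : ‖H‖ ≤ 1 := norm_seqAverage_le zero_le_one (fun j => by
    rw [CStarRing.norm_star_mul_self]; exact mul_le_one₀ (he _) (norm_nonneg _) (he _)) n
  have hH1 : ‖cornerSum H (w s)‖ ≤ 1 :=
    norm_average_corner_le_one hn (fun j => he (t j)) (hw s) hHdef
  have hv : ‖cornerSum E (w s)‖ ≤ 1 + 8 * δ := by
    have h1 := norm_cornerSum_sub_cornerSum_le hE hH (hw s) hh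
    have h2 := norm_sub_norm_le (cornerSum E (w s)) (cornerSum H (w s))
    linarith
  set v := cornerSum E (w s) with hvdef
  have hclip := norm_clipNorm_sub_le (by positivity) hv
  have hb' : ‖b‖ ≤ |C| := (hC b hb).trans (le_abs_self C)
  have hclip' : ‖clipNorm v - v‖ * ‖b‖ ≤ 8 * δ * |C| := by gcongr
  have h1 := norm_cornerSum_mul_sub_le hE (hw s) (ha b hb).2
    (hG _ (Or.inl ⟨b, hb, rfl⟩)) (hcomm b hb)
  have h2 := norm_mul_cornerSum_sub_le hE (hw s) (ha' b hb).2
    (hG _ (Or.inr ⟨b, hb, rfl⟩)) (hcomm b hb)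
  constructor
  · have h3 : clipNorm v * b - b = (clipNorm v - v) * b + (v * b - b) := by
      rw [sub_mul]; abel
    have h4 := norm_add_le ((clipNorm v - v) * b) (v * b - b)
    have h5 := norm_mul_le (clipNorm v - v) b
    rw [← h3] at h4
    exact lt_of_le_of_lt h4 (by linarith)
  · have h3 : b * clipNorm v - b = b * (clipNorm v - v) + (b * v - b) := by
      rw [mul_sub]; abel
    have h4 := norm_add_le (b * (clipNorm v - v)) (b * v - b)
    have h5 := norm_mul_le b (clipNorm v - v)
    rw [← h3] at h4
    exact lt_of_le_of_lt h4 (by linarith)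

theorem isCaiFor_of_forall_finset {X : Type*} [NonUnitalNormedRing X] {A D : Set X} {κ : Type}
    {v : κ → X} (hvA : ∀ s, v s ∈ A) (hv : ∀ s, ‖v s‖ ≤ 1)
    (h : ∀ F : Finset X, ↑F ⊆ D → ∀ δ > 0, ∃ s, ∀ b ∈ F,
      ‖v s * b - b‖ < δ ∧ ‖b * v s - b‖ < δ) : IsCaiFor X A D := by
  classical
  let J := {F : Finset X // (F : Set X) ⊆ D} × {δ : ℝ // 0 < δ}
  let T : J → Set κ := fun p =>
    {s | ∀ b ∈ p.1.1, ‖v s * b - b‖ < p.2.1 ∧ ‖b * v s - b‖ < p.2.1}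
  have : Nonempty J := ⟨⟨∅, by simp⟩, ⟨1, one_pos⟩⟩
  have hT : ∀ b ∈ D, ∀ δ > 0,
      ∀ᶠ s in ⨅ p : J, 𝓟 (T p), ‖v s * b - b‖ < δ ∧ ‖b * v s - b‖ < δ := by
    intro b hb δ hδ
    refine mem_iInf_of_mem (⟨⟨{b}, by simpa using hb⟩, ⟨δ, hδ⟩⟩ : J) ?_
    rw [mem_principal]
    exact fun s hs => hs b (Finset.mem_singleton_self b)
  refine ⟨κ, ⨅ p : J, 𝓟 (T p), v, ?_, hvA, hv, fun d hd => ?_, fun d hd => ?_⟩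
  · refine iInf_neBot_of_directed' ?_ fun p => ?_
    · intro p q
      refine ⟨⟨⟨p.1.1 ∪ q.1.1, by simpa using ⟨p.1.2, q.1.2⟩⟩,
        ⟨min p.2.1 q.2.1, lt_min p.2.2 q.2.2⟩⟩, ?_, ?_⟩ <;>
        refine principal_mono.2 fun s hs b hb => ?_
      · have := hs b (Finset.mem_union_left _ hb)
        exact ⟨this.1.trans_le (min_le_left _ _), this.2.trans_le (min_le_left _ _)⟩
      · have := hs b (Finset.mem_union_right _ hb)
        exact ⟨this.1.trans_le (min_le_right _ _), this.2.trans_le (min_le_right _ _)⟩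
    · rw [principal_neBot_iff]
      exact h p.1.1 p.1.2 p.2.1 p.2.2
  · rw [Metric.tendsto_nhds]
    intro δ hδ
    filter_upwards [hT d hd δ hδ] with s hs
    simpa using hs.1
  · rw [Metric.tendsto_nhds]
    intro δ hδ
    filter_upwards [hT d hd δ hδ] with s hs
    simpa using hs.2

/-- A net that is contractive and approximately unital modulo `A` can be replaced by one whose
members lie in the closed unit ball. -/
theorem exists_norm_le_one_approx_modulo {X : Type*} [NonUnitalNormedRing X] [NormedSpace ℂ X]
    [IsScalarTower ℂ X X] [SMulCommClass ℂ X X] {A B : Set X} (hB : IsClosedSubalg X B)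
    (hA : IsClosedSubalg X A) (hAB : A ⊆ B)
    (hAideal : ∀ a ∈ A, ∀ b ∈ B, a * b ∈ A ∧ b * a ∈ A)
    {κ : Type*} {l : Filter κ} [l.NeBot] {u : κ → X} (huB : ∀ s, u s ∈ B)
    (hu : ∀ s, infDist (u s) A ≤ 1)
    (hul : ∀ b ∈ B, Tendsto (fun s => infDist (u s * b - b) A) l (𝓝 0))
    (hur : ∀ b ∈ B, Tendsto (fun s => infDist (b * u s - b) A) l (𝓝 0)) :
    ∃ w : κ × ℕ → X, (∀ s, w s ∈ B) ∧ (∀ s, ‖w s‖ ≤ 1) ∧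
      ∀ F : Finset X, ↑F ⊆ B → ∀ δ > 0, ∃ s, ∀ b ∈ F,
        (∃ a ∈ A, ‖w s * b - b - a‖ ≤ δ) ∧ ∃ a ∈ A, ‖b * w s - b - a‖ ≤ δ := by
  have hne : A.Nonempty := ⟨0, hA.zero_mem⟩
  have hnear : ∀ (s : κ) (n : ℕ), ∃ a ∈ A, ‖u s - a‖ < 1 + 1 / ((n : ℝ) + 1) := by
    intro s n
    have h1 : infDist (u s) A < 1 + 1 / ((n : ℝ) + 1) :=
      (hu s).trans_lt (lt_add_of_pos_right _ (by positivity))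
    obtain ⟨a, ha, h⟩ := (infDist_lt_iff hne).1 h1
    exact ⟨a, ha, by rwa [← dist_eq_norm]⟩
  choose a haA ha using hnear
  refine ⟨fun p => clipNorm (u p.1 - a p.1 p.2),
    fun p => hB.smul_mem _ (hB.sub_mem (huB _) (hAB (haA _ _))),
    fun p => norm_clipNorm_le_one _, fun F hF δ hδ => ?_⟩
  obtain ⟨C, hC⟩ : ∃ C : ℝ, ∀ b ∈ F, ‖b‖ ≤ C :=
    ⟨∑ b ∈ F, ‖b‖, fun b hb => Finset.single_le_sum (fun x _ => norm_nonneg x) hb⟩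
  have hn : Tendsto (fun n : ℕ => 1 / ((n : ℝ) + 1) * |C|) atTop (𝓝 0) := by
    simpa using tendsto_one_div_add_atTop_nhds_zero_nat.mul_const |C|
  obtain ⟨n, hn⟩ := (hn.eventually_lt_const (half_pos hδ)).exists
  have hs : ∀ᶠ s in l, ∀ b ∈ F,
      infDist (u s * b - b) A < δ / 2 ∧ infDist (b * u s - b) A < δ / 2 := by
    rw [Filter.eventually_all_finset]
    exact fun b hb => ((hul b (hF hb)).eventually_lt_const (half_pos hδ)).and
      ((hur b (hF hb)).eventually_lt_const (half_pos hδ))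
  obtain ⟨s, hs⟩ := hs.exists
  refine ⟨(s, n), fun b hb => ?_⟩
  have hclip := norm_clipNorm_sub_le (by positivity) (ha s n).le
  set y := u s - a s n with hy
  have hb' : ‖b‖ ≤ |C| := (hC b hb).trans (le_abs_self C)
  have hclip' : ‖clipNorm y - y‖ * ‖b‖ ≤ 1 / ((n : ℝ) + 1) * |C| := by gcongr
  constructor
  · obtain ⟨x, hx, hxb⟩ := (infDist_lt_iff hne).1 (hs b hb).1
    rw [dist_eq_norm] at hxb
    refine ⟨x - a s n * b, hA.sub_mem hx (hAideal _ (haA s n) b (hF hb)).1, ?_⟩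
    have h1 : clipNorm y * b - b - (x - a s n * b) =
        (clipNorm y - y) * b + (u s * b - b - x) := by
      simp only [hy, sub_mul]; abel
    have h2 := norm_add_le ((clipNorm y - y) * b) (u s * b - b - x)
    have h3 := norm_mul_le (clipNorm y - y) b
    rw [← h1] at h2
    exact h2.trans (by linarith)
  · obtain ⟨x, hx, hxb⟩ := (infDist_lt_iff hne).1 (hs b hb).2
    rw [dist_eq_norm] at hxb
    refine ⟨x - b * a s n, hA.sub_mem hx (hAideal _ (haA s n) b (hF hb)).2, ?_⟩
    have h1 : b * clipNorm y - b - (x - b * a s n) =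
        b * (clipNorm y - y) + (b * u s - b - x) := by
      simp only [hy, mul_sub]; abel
    have h2 := norm_add_le (b * (clipNorm y - y)) (b * u s - b - x)
    have h3 := norm_mul_le b (clipNorm y - y)
    rw [← h1] at h2
    exact h2.trans (by linarith)

/-- Let `A` be a closed two-sided ideal with a contractive approximate identity in a closed
subalgebra `B` of a C*-algebra `X`.  Then `B` has a contractive approximate identity iff the
quotient `B/A` is approximately unital, i.e. there is a net `(u_s)` in `B` with
`dist(u_s, A) ≤ 1` such that `dist(u_s b - b, A) → 0` and `dist(b u_s - b, A) → 0` for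
every `b ∈ B`. -/
theorem stmt5 {X : Type*} [NonUnitalCStarAlgebra X]
    (B A : Set X)
    (hB : IsClosedSubalg X B)
    (hA : IsClosedSubalg X A) (hAB : A ⊆ B)
    (hAideal : ∀ a ∈ A, ∀ b ∈ B, a * b ∈ A ∧ b * a ∈ A)
    (hcai : IsCaiFor X A A) :
    IsCaiFor X B B ↔
      ∃ (ι : Type) (l : Filter ι) (u : ι → X), l.NeBot ∧
        (∀ s, u s ∈ B) ∧ (∀ s, infDist (u s) A ≤ 1) ∧
        (∀ b ∈ B, Tendsto (fun s => infDist (u s * b - b) A) l (𝓝 0)) ∧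
        (∀ b ∈ B, Tendsto (fun s => infDist (b * u s - b) A) l (𝓝 0)) := by
  have hle : ∀ x, infDist x A ≤ ‖x‖ := fun x => by
    simpa using infDist_le_dist_of_mem (x := x) hA.zero_mem
  constructor
  · rintro ⟨ι, l, e, hl, heB, he, h1, h2⟩
    exact ⟨ι, l, e, hl, heB, fun s => (hle _).trans (he s),
      fun b hb => squeeze_zero (fun _ => infDist_nonneg) (fun _ => hle _) (h1 b hb),
      fun b hb => squeeze_zero (fun _ => infDist_nonneg) (fun _ => hle _) (h2 b hb)⟩
  · rintro ⟨κ, l', u, hl', huB, hu, hul, hur⟩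
    obtain ⟨ι, l, e, hl, heA, he, h1, h2⟩ := hcai
    obtain ⟨w, hwB, hw, hwA⟩ :=
      exists_norm_le_one_approx_modulo hB hA hAB hAideal huB hu hul hur
    obtain ⟨v, hvB, hv, hvF⟩ := exists_contractive_approx_of_approx_modulo hB hA hAB hAideal
      heA he (fun a ha => tendsto_iff_norm_sub_tendsto_zero.2 (h1 a ha))
      (fun a ha => tendsto_iff_norm_sub_tendsto_zero.2 (h2 a ha)) hwB hw hwA
    exact isCaiFor_of_forall_finset hvB hv hvF
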